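/- For every δ ∈ [1/2, 1] there exists a probability measure μ on [0,1] such that, with θ of law μ and X̄_n of law P[X̄_n = k/n] = C(n,k) ∫_0^1 t^k (1-t)^{n-k} μ(dt), there exist constants 0 < c ≤ C with c·n^{−δ} ≤ d_W(X̄_n, θ) ≤ C·n^{−δ} for all n ≥ 1. -/

import Mathlib

open MeasureTheory ProbabilityTheory Set

/-- Wasserstein distance between two laws on ℝ (dual formulation):
`d_W(μ,ν) = sup over 1-Lipschitz φ of |∫φ dμ - ∫φ dν|`. -/
noncomputable def dW (μ ν : Measure ℝ) : ℝ :=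
  ⨆ φ : {f : ℝ → ℝ // LipschitzWith 1 f}, |(∫ x, φ.1 x ∂μ) - ∫ x, φ.1 x ∂ν|

/-- Law of the empirical mean `X̄ₙ` of the first `n` terms of an exchangeable 0-1 sequence
with de Finetti mixing measure `μ` : `P[X̄ₙ = k/n] = C(n,k) ∫ t^k (1-t)^(n-k) dμ(t)`. -/
noncomputable def barLaw (μ : Measure ℝ) (n : ℕ) : Measure ℝ :=
  ∑ k ∈ Finset.range (n + 1),
    (ENNReal.ofReal ((n.choose k : ℝ) * ∫ t, t ^ k * (1 - t) ^ (n - k) ∂μ)) •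
      Measure.dirac ((k : ℝ) / n)

/-- The Bernstein operator. -/
noncomputable def bernsteinOp (n : ℕ) (φ : ℝ → ℝ) (t : ℝ) : ℝ :=
  ∑ k ∈ Finset.range (n + 1), (bernsteinPolynomial ℝ n k).eval t * φ ((k : ℝ) / n)

lemma bernsteinPolynomial_eval_eq (n k : ℕ) (t : ℝ) :
    (bernsteinPolynomial ℝ n k).eval t = (n.choose k : ℝ) * (t ^ k * (1 - t) ^ (n - k)) := by
  simp [bernsteinPolynomial, mul_assoc]

lemma bernsteinPolynomial_eval_nonneg (n k : ℕ) {t : ℝ} (ht : t ∈ Icc (0 : ℝ) 1) :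
    0 ≤ (bernsteinPolynomial ℝ n k).eval t := by
  rw [bernsteinPolynomial_eval_eq]
  have h0 := ht.1
  have h1 : 0 ≤ 1 - t := by linarith [ht.2]
  positivity

lemma sum_bernsteinPolynomial_eval (n : ℕ) (t : ℝ) :
    ∑ k ∈ Finset.range (n + 1), (bernsteinPolynomial ℝ n k).eval t = 1 := by
  have := congrArg (Polynomial.eval t) (bernsteinPolynomial.sum ℝ n)
  simpa [Polynomial.eval_finsetSum] using this

lemma bernsteinOp_id {n : ℕ} (hn : 1 ≤ n) (t : ℝ) : bernsteinOp n (fun x => x) t = t := by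
  have h := congrArg (Polynomial.eval t) (bernsteinPolynomial.sum_smul ℝ n)
  have hn' : (n : ℝ) ≠ 0 := by positivity
  simp only [Polynomial.eval_finsetSum, nsmul_eq_mul, Polynomial.eval_mul,
    Polynomial.eval_natCast, Polynomial.eval_X] at h
  have : bernsteinOp n (fun x => x) t = (n * t) / n := by
    rw [← h, Finset.sum_div, bernsteinOp]
    exact Finset.sum_congr rfl fun k _ => by ring
  rw [this]; field_simp

lemma bernsteinOp_sq_sub {n : ℕ} (hn : 1 ≤ n) (t : ℝ) :
    bernsteinOp n (fun x => (x - t) ^ 2) t = t * (1 - t) / n := by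
  have h := congrArg (Polynomial.eval t) (bernsteinPolynomial.variance ℝ n)
  have hn' : (n : ℝ) ≠ 0 := by positivity
  simp only [Polynomial.eval_finsetSum, nsmul_eq_mul, Polynomial.eval_mul,
    Polynomial.eval_natCast, Polynomial.eval_X, Polynomial.eval_pow, Polynomial.eval_sub,
    Polynomial.eval_one] at h
  have : bernsteinOp n (fun x => (x - t) ^ 2) t = (n * t * (1 - t)) / n ^ 2 := by
    rw [← h, Finset.sum_div, bernsteinOp]
    exact Finset.sum_congr rfl fun k _ => by field_simp; ring
  rw [this]; field_simp

lemma bernsteinOp_mono {n : ℕ} {φ ψ : ℝ → ℝ} (h : ∀ x, φ x ≤ ψ x) {t : ℝ}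
    (ht : t ∈ Icc (0 : ℝ) 1) : bernsteinOp n φ t ≤ bernsteinOp n ψ t :=
  Finset.sum_le_sum fun k _ =>
    mul_le_mul_of_nonneg_left (h _) (bernsteinPolynomial_eval_nonneg n k ht)

lemma bernsteinOp_affine {n : ℕ} (hn : 1 ≤ n) (a b t : ℝ) :
    bernsteinOp n (fun x => a + b * x) t = a + b * t := by
  have h1 := sum_bernsteinPolynomial_eval n t
  have h2 := bernsteinOp_id hn t
  simp only [bernsteinOp] at h2 ⊢
  calc _ = a * ∑ k ∈ Finset.range (n + 1), (bernsteinPolynomial ℝ n k).eval t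
        + b * ∑ k ∈ Finset.range (n + 1),
          (bernsteinPolynomial ℝ n k).eval t * ((k : ℝ) / n) := by
        rw [Finset.mul_sum, Finset.mul_sum, ← Finset.sum_add_distrib]
        exact Finset.sum_congr rfl fun k _ => by ring
    _ = _ := by rw [h1, h2]; ring

/-- Comparison of a function with an affine function up to a quadratic error. -/
lemma abs_bernsteinOp_sub_le_of_affine {n : ℕ} (hn : 1 ≤ n) {φ : ℝ → ℝ} {t a b c : ℝ} (hc : 0 ≤ c)
    (ht : t ∈ Icc (0 : ℝ) 1)
    (h : ∀ x, |φ x - φ t - a * (x - t)| ≤ b + c * (x - t) ^ 2) :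
    |bernsteinOp n φ t - φ t| ≤ b + c / (4 * n) := by
  have hn' : (0 : ℝ) < n := by positivity
  have h0 := sum_bernsteinPolynomial_eval n t
  have h1 := bernsteinOp_id hn t
  have h2 := bernsteinOp_sq_sub hn t
  simp only [bernsteinOp] at h1 h2
  have key : bernsteinOp n φ t - φ t = ∑ k ∈ Finset.range (n + 1),
      (bernsteinPolynomial ℝ n k).eval t * (φ ((k : ℝ) / n) - φ t - a * ((k : ℝ) / n - t)) := by
    have e : ∀ k : ℕ, (bernsteinPolynomial ℝ n k).eval t *
        (φ ((k : ℝ) / n) - φ t - a * ((k : ℝ) / n - t)) =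
        (bernsteinPolynomial ℝ n k).eval t * φ ((k : ℝ) / n)
        + (bernsteinPolynomial ℝ n k).eval t * (-φ t + a * t)
        + (bernsteinPolynomial ℝ n k).eval t * ((k : ℝ) / n) * (-a) := fun k => by ring
    simp_rw [e, Finset.sum_add_distrib, ← Finset.sum_mul]
    rw [h0, h1, bernsteinOp]; ring
  rw [key]
  calc _ ≤ ∑ k ∈ Finset.range (n + 1), (bernsteinPolynomial ℝ n k).eval t *
        (b + c * ((k : ℝ) / n - t) ^ 2) := by
        refine (Finset.abs_sum_le_sum_abs _ _).trans (Finset.sum_le_sum fun k _ => ?_)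
        rw [abs_mul, abs_of_nonneg (bernsteinPolynomial_eval_nonneg n k ht)]
        exact mul_le_mul_of_nonneg_left (h _) (bernsteinPolynomial_eval_nonneg n k ht)
    _ = b + c * (t * (1 - t) / n) := by
        have e : ∀ k : ℕ, (bernsteinPolynomial ℝ n k).eval t *
            (b + c * ((k : ℝ) / n - t) ^ 2) = (bernsteinPolynomial ℝ n k).eval t * b
            + (bernsteinPolynomial ℝ n k).eval t * ((k : ℝ) / n - t) ^ 2 * c := fun k => by ring
        simp_rw [e, Finset.sum_add_distrib, ← Finset.sum_mul]
        rw [h0, h2]; ring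
    _ ≤ _ := by
        have : t * (1 - t) / n ≤ 1 / (4 * n) := by
          rw [div_le_div_iff₀ hn' (by positivity)]
          nlinarith [sq_nonneg (2 * t - 1)]
        calc _ ≤ b + c * (1 / (4 * n)) := by gcongr
          _ = _ := by ring

lemma LipschitzWith.abs_sub_le {φ : ℝ → ℝ} (hφ : LipschitzWith 1 φ) (x y : ℝ) :
    |φ x - φ y| ≤ |x - y| := by
  simpa [Real.dist_eq] using hφ.dist_le_mul x y

lemma LipschitzWith.abs_bernsteinOp_sub_le {n : ℕ} (hn : 1 ≤ n) {φ : ℝ → ℝ}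
    (hφ : LipschitzWith 1 φ) {t : ℝ} (ht : t ∈ Icc (0 : ℝ) 1) :
    |bernsteinOp n φ t - φ t| ≤ 1 / √n := by
  have hn' : (0 : ℝ) < n := by positivity
  have hs : 0 < √(n : ℝ) := by positivity
  have hss : √(n : ℝ) ^ 2 = n := Real.sq_sqrt hn'.le
  refine (abs_bernsteinOp_sub_le_of_affine hn (a := 0) (b := 1 / (2 * √n)) (c := √n / 2)
    (by positivity) ht fun x => ?_).trans ?_
  · have h1 := hφ.abs_sub_le x t
    have h2 : |x - t| ≤ 1 / (2 * √n) + √n / 2 * |x - t| ^ 2 := by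
      have : 1 / (2 * √n) + √n / 2 * |x - t| ^ 2 - |x - t|
        = (√n * |x - t| - 1) ^ 2 / (2 * √n) := by field_simp; ring
      have h3 : 0 ≤ (√n * |x - t| - 1) ^ 2 / (2 * √n) := by positivity
      linarith
    rw [sq_abs] at h2
    simpa using h1.trans h2
  · rw [← hss]
    have : 1 / (2 * √(n : ℝ)) + √n / 2 / (4 * √n ^ 2) = (5 / 8) * (1 / √n) := by
      field_simp; ring
    rw [Real.sqrt_sq hs.le, this]
    have : 0 < 1 / √(n : ℝ) := by positivity
    linarith

lemma continuous_bernsteinOp (n : ℕ) (φ : ℝ → ℝ) : Continuous (bernsteinOp n φ) := by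
  unfold bernsteinOp
  exact continuous_finsetSum _ fun k _ => (Polynomial.continuous _).mul continuous_const

lemma hasDerivAt_bernsteinOp_succ (n : ℕ) (Φ : ℝ → ℝ) (t : ℝ) :
    HasDerivAt (bernsteinOp (n + 1) Φ)
      (∑ k ∈ Finset.range (n + 1), (bernsteinPolynomial ℝ n k).eval t *
        ((n + 1) * (Φ (((k : ℝ) + 1) / (n + 1)) - Φ ((k : ℝ) / (n + 1))))) t := by
  have h : HasDerivAt (bernsteinOp (n + 1) Φ)
      (∑ k ∈ Finset.range (n + 1 + 1), (Polynomial.derivative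
        (bernsteinPolynomial ℝ (n + 1) k)).eval t * Φ ((k : ℝ) / (n + 1 : ℕ))) t := by
    unfold bernsteinOp
    exact HasDerivAt.fun_sum fun k _ => (Polynomial.hasDerivAt _ t).mul_const _
  convert h using 1
  rw [Finset.sum_range_succ' _ (n + 1), bernsteinPolynomial.derivative_zero]
  simp only [bernsteinPolynomial.derivative_succ]
  have hz : (bernsteinPolynomial ℝ n (n + 1)) = 0 :=
    bernsteinPolynomial.eq_zero_of_lt ℝ (Nat.lt_succ_self n)
  have hshift : ∑ k ∈ Finset.range (n + 1), (bernsteinPolynomial ℝ n (k + 1)).eval t *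
        Φ (((k + 1 : ℕ) : ℝ) / (n + 1))
      + (bernsteinPolynomial ℝ n 0).eval t * Φ (((0 : ℕ) : ℝ) / (n + 1))
      = ∑ k ∈ Finset.range (n + 1), (bernsteinPolynomial ℝ n k).eval t *
        Φ ((k : ℝ) / (n + 1)) := by
    rw [← Finset.sum_range_succ' (fun k : ℕ => (bernsteinPolynomial ℝ n k).eval t *
        Φ ((k : ℝ) / (n + 1))), Finset.sum_range_succ, hz]
    simp
  simp only [mul_sub, Finset.sum_sub_distrib]
  simp only [Polynomial.eval_mul, Polynomial.eval_sub, Polynomial.eval_natCast,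
    Polynomial.eval_add, Polynomial.eval_one, Nat.add_sub_cancel, Polynomial.eval_neg,
    Nat.cast_add, Nat.cast_one, sub_mul,
    Finset.sum_sub_distrib] at hshift ⊢
  have e1 : ∀ f : ℕ → ℝ, ∀ g : ℕ → ℝ, ∑ k ∈ Finset.range (n + 1), f k * ((n + 1) * g k) =
      (n + 1) * ∑ k ∈ Finset.range (n + 1), f k * g k := fun f g => by
    rw [Finset.mul_sum]; exact Finset.sum_congr rfl fun k _ => by ring
  have e2 : ∀ f : ℕ → ℝ, ∀ g : ℕ → ℝ, ∑ k ∈ Finset.range (n + 1), (n + 1) * f k * g k =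
      (n + 1) * ∑ k ∈ Finset.range (n + 1), f k * g k := fun f g => by
    rw [Finset.mul_sum]; exact Finset.sum_congr rfl fun k _ => by ring
  rw [e1, e1, e2, e2, ← hshift]
  ring

/-- Integrating over an interval improves the rate of Bernstein approximation of Lipschitz
functions from `n ^ (-1/2)` to `n ^ (-1)`. -/
lemma LipschitzWith.abs_integral_bernsteinOp_sub_le {n : ℕ} (hn : 1 ≤ n) {φ : ℝ → ℝ}
    (hφ : LipschitzWith 1 φ) {a b : ℝ} (ha : 0 ≤ a) (hab : a ≤ b) (hb : b ≤ 1) :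
    |∫ t in a..b, (bernsteinOp n φ t - φ t)| ≤ 2 / n := by
  have hn' : (0 : ℝ) < n := by positivity
  have hφi : ∀ x y, IntervalIntegrable φ volume x y :=
    fun x y => hφ.continuous.intervalIntegrable x y
  set Φ : ℝ → ℝ := fun x => ∫ s in (0 : ℝ)..x, φ s with hΦ
  have hdiff : ∀ x y, Φ x - Φ y = ∫ s in y..x, φ s := fun x y =>
    intervalIntegral.integral_interval_sub_left (hφi _ _) (hφi _ _)
  set D : ℝ → ℝ := fun t => ∑ k ∈ Finset.range (n + 1), (bernsteinPolynomial ℝ n k).eval t *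
        ((n + 1) * (Φ (((k : ℝ) + 1) / (n + 1)) - Φ ((k : ℝ) / (n + 1)))) with hD
  have hDcont : Continuous D :=
    continuous_finsetSum _ fun k _ => (Polynomial.continuous _).mul continuous_const
  have hDint : ∫ t in a..b, D t = bernsteinOp (n + 1) Φ b - bernsteinOp (n + 1) Φ a :=
    intervalIntegral.integral_eq_sub_of_hasDerivAt
      (fun t _ => hasDerivAt_bernsteinOp_succ n Φ t) (hDcont.intervalIntegrable _ _)
  have hTaylor : ∀ t ∈ Icc (0 : ℝ) 1, |bernsteinOp (n + 1) Φ t - Φ t| ≤ 1 / (4 * (n + 1)) := by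
    intro t ht
    have := abs_bernsteinOp_sub_le_of_affine (n := n + 1) (by omega) (φ := Φ) (a := φ t)
      (b := 0) (c := 1)
      zero_le_one ht fun x => ?_
    · simpa using this
    · have e : Φ x - Φ t - φ t * (x - t) = ∫ s in t..x, (φ s - φ t) := by
        rw [intervalIntegral.integral_sub (hφi _ _) intervalIntegrable_const, hdiff]
        simp [mul_comm]
      rw [e]
      have := intervalIntegral.norm_integral_le_of_norm_le_const (a := t) (b := x)
        (f := fun s => φ s - φ t) (C := |x - t|) fun s hs => ?_
      · rw [Real.norm_eq_abs, ← sq, sq_abs] at this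
        linarith
      · refine (hφ.abs_sub_le s t).trans ?_
        rw [abs_sub_comm s t, abs_sub_comm x t]
        have := Set.abs_sub_left_of_mem_uIcc (Set.uIoc_subset_uIcc hs)
        rwa [abs_sub_comm s t, abs_sub_comm x t] at this
  have hclose : ∀ t ∈ Icc (0 : ℝ) 1, |bernsteinOp n φ t - D t| ≤ 1 / (n + 1) := by
    intro t ht
    have e : bernsteinOp n φ t - D t = ∑ k ∈ Finset.range (n + 1),
        (bernsteinPolynomial ℝ n k).eval t * (φ ((k : ℝ) / n) -
        ((n + 1) * (Φ (((k : ℝ) + 1) / (n + 1)) - Φ ((k : ℝ) / (n + 1))))) := by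
      simp only [mul_sub (Polynomial.eval _ _), Finset.sum_sub_distrib, hD, bernsteinOp]
    rw [e]
    calc _ ≤ ∑ k ∈ Finset.range (n + 1), (bernsteinPolynomial ℝ n k).eval t * (1 / (n + 1)) := by
          refine (Finset.abs_sum_le_sum_abs _ _).trans (Finset.sum_le_sum fun k hk => ?_)
          rw [abs_mul, abs_of_nonneg (bernsteinPolynomial_eval_nonneg n k ht)]
          refine mul_le_mul_of_nonneg_left ?_ (bernsteinPolynomial_eval_nonneg n k ht)
          have hkn : (k : ℝ) ≤ n := by
            exact_mod_cast Nat.lt_succ_iff.1 (Finset.mem_range.1 hk)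
          have hk0 : (0 : ℝ) ≤ k := by positivity
          have hlen : ((k : ℝ) + 1) / (n + 1) - (k : ℝ) / (n + 1) = 1 / (n + 1) := by
            field_simp; ring
          have hle : (k : ℝ) / (n + 1) ≤ ((k : ℝ) + 1) / (n + 1) := by gcongr; linarith
          have h1 : (k : ℝ) / (n + 1) ≤ k / n := by gcongr; linarith
          have h2 : (k : ℝ) / n ≤ (k + 1) / (n + 1) := by
            rw [div_le_div_iff₀ hn' (by positivity)]; nlinarith
          have e2 : φ ((k : ℝ) / n) -
              ((n + 1) * (Φ (((k : ℝ) + 1) / (n + 1)) - Φ ((k : ℝ) / (n + 1)))) =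
              (n + 1) * ∫ s in ((k : ℝ) / (n + 1))..(((k : ℝ) + 1) / (n + 1)),
                (φ ((k : ℝ) / n) - φ s) := by
            rw [intervalIntegral.integral_sub intervalIntegrable_const (hφi _ _), hdiff,
              intervalIntegral.integral_const, hlen, smul_eq_mul]
            field_simp
          rw [e2, abs_mul, abs_of_pos (by positivity : (0 : ℝ) < n + 1)]
          have := intervalIntegral.norm_integral_le_of_norm_le_const
            (a := (k : ℝ) / (n + 1)) (b := ((k : ℝ) + 1) / (n + 1))
            (f := fun s => φ ((k : ℝ) / n) - φ s) (C := 1 / (n + 1)) fun s hs => ?_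
          · rw [Real.norm_eq_abs, hlen, abs_of_pos (by positivity : (0 : ℝ) < 1 / (n + 1))] at this
            calc _ ≤ ((n : ℝ) + 1) * (1 / (n + 1) * (1 / (n + 1))) := by gcongr
              _ = _ := by field_simp
          · rw [uIoc_of_le hle] at hs
            refine (hφ.abs_sub_le _ _).trans ?_
            rw [abs_le]; constructor <;> linarith [hs.1, hs.2]
      _ = _ := by rw [← Finset.sum_mul, sum_bernsteinPolynomial_eval, one_mul]
  have hBi := (continuous_bernsteinOp n φ).intervalIntegrable (μ := volume) a b
  have hsplit : ∫ t in a..b, (bernsteinOp n φ t - φ t) =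
      (∫ t in a..b, (bernsteinOp n φ t - D t)) + (bernsteinOp (n + 1) Φ b - Φ b)
        - (bernsteinOp (n + 1) Φ a - Φ a) := by
    rw [intervalIntegral.integral_sub hBi (hφi _ _),
      intervalIntegral.integral_sub hBi (hDcont.intervalIntegrable _ _), hDint, ← hdiff]
    ring
  have h1 : |∫ t in a..b, (bernsteinOp n φ t - D t)| ≤ 1 / (n + 1) := by
    have := intervalIntegral.norm_integral_le_of_norm_le_const (a := a) (b := b)
      (f := fun t => bernsteinOp n φ t - D t) (C := 1 / (n + 1)) fun t ht => by
        rw [uIoc_of_le hab] at ht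
        exact hclose t ⟨by linarith [ht.1], by linarith [ht.2]⟩
    rw [Real.norm_eq_abs] at this
    refine this.trans (mul_le_of_le_one_right (by positivity) ?_)
    rw [abs_of_nonneg (by linarith)]; linarith
  have h2 := hTaylor b ⟨by linarith, hb⟩
  have h3 := hTaylor a ⟨ha, by linarith⟩
  have h4 : 1 / ((n : ℝ) + 1) + 1 / (4 * (n + 1)) + 1 / (4 * (n + 1)) ≤ 2 / n := by
    have : 1 / ((n : ℝ) + 1) + 1 / (4 * (n + 1)) + 1 / (4 * (n + 1)) = (3 / 2) / (n + 1) := by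
      field_simp; ring
    rw [this]; gcongr <;> linarith
  rw [hsplit]
  rw [abs_le] at h1 h2 h3 ⊢
  constructor <;> linarith [h1.1, h1.2, h2.1, h2.2, h3.1, h3.2]

lemma norm_sum_bernsteinPolynomial_eval_exp_sq (n : ℕ) (t u : ℝ) :
    ‖∑ k ∈ Finset.range (n + 1), (((bernsteinPolynomial ℝ n k).eval t : ℝ) : ℂ) *
      Complex.exp (k * (u * Complex.I))‖ ^ 2
      = (1 - 2 * (t * (1 - t)) * (1 - Real.cos u)) ^ n := by
  have h : ∑ k ∈ Finset.range (n + 1), (((bernsteinPolynomial ℝ n k).eval t : ℝ) : ℂ) *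
      Complex.exp (k * (u * Complex.I)) = (t * Complex.exp (u * Complex.I) + (1 - t)) ^ n := by
    rw [add_pow]
    refine Finset.sum_congr rfl fun k _ => ?_
    rw [bernsteinPolynomial_eval_eq, Complex.exp_nat_mul]
    push_cast
    ring
  rw [h, norm_pow, ← pow_mul, mul_comm n 2, pow_mul, ← Complex.normSq_eq_norm_sq]
  congr 1
  rw [Complex.exp_mul_I, Complex.normSq_apply]
  simp only [← Complex.ofReal_cos, ← Complex.ofReal_sin, Complex.add_re, Complex.add_im,
    Complex.mul_re, Complex.mul_im, Complex.ofReal_re, Complex.ofReal_im, Complex.I_re,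
    Complex.I_im, Complex.sub_re, Complex.sub_im, Complex.one_re, Complex.one_im]
  linear_combination t ^ 2 * Real.sin_sq_add_cos_sq u

lemma bernsteinOp_cos_le {n : ℕ} (hn : 1 ≤ n) {t : ℝ} (ht : t ∈ Icc (1 / 2 : ℝ) (3 / 4)) :
    bernsteinOp n (fun x => Real.cos (√n * (x - 1 / 2))) t ≤ 97 / 100 := by
  have hn' : (0 : ℝ) < n := by positivity
  have hn1 : (1 : ℝ) ≤ n := by exact_mod_cast hn
  have hs : 0 < √(n : ℝ) := by positivity
  have hss : √(n : ℝ) ^ 2 = n := Real.sq_sqrt hn'.le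
  have hs1 : 1 ≤ √(n : ℝ) := Real.one_le_sqrt.2 hn1
  set u : ℝ := 1 / √n with hu
  have hu2 : u ^ 2 = 1 / n := by rw [hu, div_pow, hss, one_pow]
  set S : ℂ := ∑ k ∈ Finset.range (n + 1), (((bernsteinPolynomial ℝ n k).eval t : ℝ) : ℂ) *
      Complex.exp (k * (u * Complex.I)) with hS
  have hre : bernsteinOp n (fun x => Real.cos (√n * (x - 1 / 2))) t =
      (Complex.exp ((-(√n / 2) : ℝ) * Complex.I) * S).re := by
    rw [hS, Finset.mul_sum, Complex.re_sum, bernsteinOp]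
    refine Finset.sum_congr rfl fun k _ => ?_
    have e : Complex.exp ((-(√n / 2) : ℝ) * Complex.I) *
        ((((bernsteinPolynomial ℝ n k).eval t : ℝ) : ℂ) * Complex.exp (k * (u * Complex.I))) =
        (((bernsteinPolynomial ℝ n k).eval t : ℝ) : ℂ) *
          Complex.exp ((√n * ((k : ℝ) / n - 1 / 2) : ℝ) * Complex.I) := by
      rw [mul_left_comm, ← Complex.exp_add]
      congr 2
      have : √(n : ℝ) * ((k : ℝ) / n - 1 / 2) = -(√n / 2) + k * u := by
        rw [hu]; nth_rw 2 [← hss]; field_simp; ring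
      rw [this]; push_cast; ring
    rw [e, Complex.re_ofReal_mul, Complex.exp_ofReal_mul_I_re]
  have hnorm : bernsteinOp n (fun x => Real.cos (√n * (x - 1 / 2))) t ≤ ‖S‖ := by
    rw [hre]
    refine (Complex.re_le_norm _).trans ?_
    rw [norm_mul, Complex.norm_exp_ofReal_mul_I, one_mul]
  have hu0 : 0 < u := by positivity
  have hu1 : u ≤ 1 := by rw [hu, div_le_one hs]; exact hs1
  have hcos : Real.cos u ≤ 1 - u ^ 2 / 5 := by
    have h1 := Real.cos_le_one_sub_mul_cos_sq (x := u)
      (by rw [abs_of_pos hu0]; linarith [Real.pi_gt_three])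
    have h2 : Real.pi ^ 2 ≤ 10 := by nlinarith [Real.pi_lt_d2, Real.pi_pos]
    have h3 : 1 / 5 ≤ 2 / Real.pi ^ 2 := by
      rw [div_le_div_iff₀ (by norm_num) (by positivity)]; linarith
    nlinarith [sq_nonneg u]
  have htt : 3 / 16 ≤ t * (1 - t) := by nlinarith [ht.1, ht.2]
  have hbase : 1 - 2 * (t * (1 - t)) * (1 - Real.cos u) ≤ 1 - (3 / 40) / n := by
    have : (3 / 40) / (n : ℝ) = 2 * (3 / 16) * (u ^ 2 / 5) := by rw [hu2]; ring
    rw [this]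
    have : 2 * (3 / 16) * (u ^ 2 / 5) ≤ 2 * (t * (1 - t)) * (1 - Real.cos u) := by
      gcongr
      linarith
    linarith
  have hbase0 : 0 ≤ 1 - 2 * (t * (1 - t)) * (1 - Real.cos u) := by
    have h1 : 2 * (t * (1 - t)) ≤ 1 / 2 := by nlinarith [sq_nonneg (2 * t - 1)]
    have h2 : 1 - Real.cos u ≤ 2 := by linarith [Real.neg_one_le_cos u]
    have h3 : 0 ≤ 1 - Real.cos u := by linarith [Real.cos_le_one u]
    nlinarith
  have hS2 : ‖S‖ ^ 2 ≤ Real.exp (-(3 / 40)) := by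
    rw [hS, norm_sum_bernsteinPolynomial_eval_exp_sq]
    calc _ ≤ (1 - (3 / 40) / (n : ℝ)) ^ n := by gcongr
      _ ≤ _ := Real.one_sub_div_pow_le_exp_neg (by linarith)
  have hexp : Real.exp (-(3 / 40)) ≤ 40 / 43 := by
    rw [Real.exp_neg, inv_le_comm₀ (Real.exp_pos _) (by norm_num)]
    have := Real.add_one_le_exp (3 / 40 : ℝ)
    norm_num at this ⊢
    linarith
  have : ‖S‖ ≤ 97 / 100 := abs_le_of_sq_le_sq' (by norm_num; linarith) (by norm_num) |>.2
  linarith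

lemma le_bernsteinOp_abs_sub_half {n : ℕ} (hn : 1 ≤ n) {t : ℝ}
    (ht : 1 / 2 ≤ t) (ht' : t ≤ 1 / 2 + 1 / (100 * √n)) :
    1 / (100 * √n) ≤ bernsteinOp n (fun x => |x - 1 / 2|) t - |t - 1 / 2| := by
  have hn1 : (1 : ℝ) ≤ n := by exact_mod_cast hn
  have hs1 : 1 ≤ √(n : ℝ) := Real.one_le_sqrt.2 hn1
  have hs : 0 < √(n : ℝ) := by positivity
  have h100 : 1 / (100 * √(n : ℝ)) ≤ 1 / 100 := by
    gcongr; linarith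
  have h1 := bernsteinOp_cos_le hn (t := t) ⟨ht, by linarith⟩
  have h2 : bernsteinOp n (fun x => (1 - Real.cos (√n * (x - 1 / 2))) / √n) t ≤
      bernsteinOp n (fun x => |x - 1 / 2|) t := by
    refine bernsteinOp_mono (fun x => ?_) ⟨by linarith, by linarith⟩
    rw [div_le_iff₀ hs]
    set y := √n * (x - 1 / 2) with hy
    have : |x - 1 / 2| * √n = |y| := by rw [hy, abs_mul, abs_of_pos hs, mul_comm]
    rw [this]
    have ha := Real.one_sub_sq_div_two_le_cos (x := y)
    have hb := Real.neg_one_le_cos y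
    rw [← sq_abs] at ha
    by_cases hy2 : |y| ≤ 2
    · nlinarith [abs_nonneg y]
    · linarith
  have h3 : bernsteinOp n (fun x => (1 - Real.cos (√n * (x - 1 / 2))) / √n) t =
      (1 - bernsteinOp n (fun x => Real.cos (√n * (x - 1 / 2))) t) / √n := by
    have h0 := sum_bernsteinPolynomial_eval n t
    calc _ = (∑ k ∈ Finset.range (n + 1), (bernsteinPolynomial ℝ n k).eval t -
          bernsteinOp n (fun x => Real.cos (√n * (x - 1 / 2))) t) / √n := by
          rw [bernsteinOp, bernsteinOp, ← Finset.sum_sub_distrib, Finset.sum_div]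
          exact Finset.sum_congr rfl fun k _ => by ring
      _ = _ := by rw [h0]
  have h4 : (3 / 100) / √(n : ℝ) ≤
      (1 - bernsteinOp n (fun x => Real.cos (√n * (x - 1 / 2))) t) / √n := by
    gcongr; linarith
  have h5 : (3 / 100) / √(n : ℝ) = 3 * (1 / (100 * √n)) := by field_simp
  have h6 : 0 < 1 / (100 * √(n : ℝ)) := by positivity
  rw [abs_of_nonneg (by linarith : 0 ≤ t - 1 / 2)]
  linarith

lemma Continuous.integrable_of_measure_compl_Icc_eq_zero {μ : Measure ℝ} [IsFiniteMeasure μ]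
    (hμ : μ (Icc (0 : ℝ) 1)ᶜ = 0) {f : ℝ → ℝ} (hf : Continuous f) : Integrable f μ := by
  have hae : ∀ᵐ t ∂μ, t ∈ Icc (0 : ℝ) 1 := by
    rw [ae_iff]; exact hμ
  rw [← Measure.restrict_eq_self_of_ae_mem hae]
  exact hf.continuousOn.integrableOn_compact isCompact_Icc

/-- Integration against `barLaw μ n` is integration of the Bernstein operator against `μ`. -/
lemma integral_barLaw {μ : Measure ℝ} [IsFiniteMeasure μ] (hμ : μ (Icc (0 : ℝ) 1)ᶜ = 0) (n : ℕ)
    (φ : ℝ → ℝ) : ∫ x, φ x ∂(barLaw μ n) = ∫ t, bernsteinOp n φ t ∂μ := by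
  have hae : ∀ᵐ t ∂μ, t ∈ Icc (0 : ℝ) 1 := by
    rw [ae_iff]; exact hμ
  have hcoef : ∀ k, (n.choose k : ℝ) * ∫ t, t ^ k * (1 - t) ^ (n - k) ∂μ =
      ∫ t, (bernsteinPolynomial ℝ n k).eval t ∂μ := fun k => by
    simp_rw [bernsteinPolynomial_eval_eq, integral_const_mul]
  unfold barLaw bernsteinOp
  rw [integral_finsetSum_measure fun k _ =>
      (integrable_dirac (by simp)).smul_measure ENNReal.ofReal_ne_top,
    integral_finsetSum _ fun k _ => ((Polynomial.continuous
      _).integrable_of_measure_compl_Icc_eq_zero hμ).mul_const _]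
  refine Finset.sum_congr rfl fun k _ => ?_
  rw [integral_smul_measure, integral_dirac, hcoef, integral_mul_const, smul_eq_mul,
    ENNReal.toReal_ofReal]
  exact integral_nonneg_of_ae (hae.mono fun t ht => bernsteinPolynomial_eval_nonneg n k ht)

lemma abs_sub_half_le_bernsteinOp {n : ℕ} (hn : 1 ≤ n) {t : ℝ} (ht : t ∈ Icc (0 : ℝ) 1) :
    |t - 1 / 2| ≤ bernsteinOp n (fun x => |x - 1 / 2|) t := by
  have h1 := bernsteinOp_mono (n := n) (φ := fun x => -(1 / 2) + 1 * x)
    (ψ := fun x => |x - 1 / 2|) (fun x => by linarith [le_abs_self (x - 1 / 2)]) ht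
  have h2 := bernsteinOp_mono (n := n) (φ := fun x => 1 / 2 + (-1) * x)
    (ψ := fun x => |x - 1 / 2|) (fun x => by linarith [neg_abs_le (x - 1 / 2)]) ht
  rw [bernsteinOp_affine hn] at h1 h2
  rw [abs_le]
  constructor <;> linarith

lemma lipschitzWith_abs_sub_half : LipschitzWith 1 (fun x : ℝ => |x - 1 / 2|) :=
  LipschitzWith.of_dist_le_mul fun x y => by
    simp only [Real.dist_eq, NNReal.coe_one, one_mul]
    refine (abs_abs_sub_abs_le_abs_sub _ _).trans (le_of_eq ?_)
    congr 1; ring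

/-- Two-sided bounds on `dW (barLaw μ n) μ` from a bound on the averaged Bernstein error and from
the mass of `μ` near `1 / 2`. -/
lemma dW_barLaw_bounds {μ : Measure ℝ} [IsProbabilityMeasure μ] (hμ : μ (Icc (0 : ℝ) 1)ᶜ = 0)
    {n : ℕ} (hn : 1 ≤ n) {K : ℝ}
    (hK : ∀ φ : ℝ → ℝ, LipschitzWith 1 φ → |∫ t, (bernsteinOp n φ t - φ t) ∂μ| ≤ K) :
    1 / (100 * √n) * μ.real (Icc (1 / 2) (1 / 2 + 1 / (100 * √n))) ≤ dW (barLaw μ n) μ ∧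
      dW (barLaw μ n) μ ≤ K := by
  have hgap : ∀ φ : ℝ → ℝ, LipschitzWith 1 φ → (∫ x, φ x ∂(barLaw μ n)) - ∫ x, φ x ∂μ =
      ∫ t, (bernsteinOp n φ t - φ t) ∂μ := fun φ hφ => by
    rw [integral_barLaw hμ, integral_sub
      ((continuous_bernsteinOp n φ).integrable_of_measure_compl_Icc_eq_zero hμ)
      (hφ.continuous.integrable_of_measure_compl_Icc_eq_zero hμ)]
  have hle : ∀ φ : {f : ℝ → ℝ // LipschitzWith 1 f},
      |(∫ x, φ.1 x ∂(barLaw μ n)) - ∫ x, φ.1 x ∂μ| ≤ K := fun φ => by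
    rw [hgap φ.1 φ.2]; exact hK φ.1 φ.2
  have : Nonempty {f : ℝ → ℝ // LipschitzWith 1 f} := ⟨⟨_, LipschitzWith.id⟩⟩
  refine ⟨?_, ciSup_le hle⟩
  refine le_trans ?_ (le_ciSup ⟨K, by rintro _ ⟨φ, rfl⟩; exact hle φ⟩
    ⟨fun x : ℝ => |x - 1 / 2|, lipschitzWith_abs_sub_half⟩)
  simp only
  rw [hgap _ lipschitzWith_abs_sub_half]
  refine le_trans ?_ (le_abs_self _)
  set W := Icc (1 / 2 : ℝ) (1 / 2 + 1 / (100 * √n))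
  have hcont : Continuous fun t => bernsteinOp n (fun x => |x - 1 / 2|) t - |t - 1 / 2| :=
    (continuous_bernsteinOp n _).sub lipschitzWith_abs_sub_half.continuous
  have hint := hcont.integrable_of_measure_compl_Icc_eq_zero hμ
  calc _ = ∫ t in W, 1 / (100 * √n) ∂μ := by rw [setIntegral_const, smul_eq_mul, mul_comm]
    _ ≤ ∫ t in W, (bernsteinOp n (fun x => |x - 1 / 2|) t - |t - 1 / 2|) ∂μ :=
        setIntegral_mono_on (integrable_const _) hint.integrableOn measurableSet_Icc
          fun t ht => le_bernsteinOp_abs_sub_half hn ht.1 ht.2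
    _ ≤ _ := by
        refine setIntegral_le_integral hint ?_
        have hae : ∀ᵐ t ∂μ, t ∈ Icc (0 : ℝ) 1 := by
          rw [ae_iff]; exact hμ
        exact hae.mono fun t ht => sub_nonneg.2 (abs_sub_half_le_bernsteinOp hn ht)

/-- A one-sided form of the second mean value theorem for integrals. -/
lemma abs_integral_mul_le_of_deriv_nonpos {ρ ρ' g : ℝ → ℝ} {a b M : ℝ} (hab : a ≤ b)
    (hρ : ∀ x ∈ Icc a b, HasDerivAt ρ (ρ' x) x) (hρ' : ContinuousOn ρ' (Icc a b))
    (hneg : ∀ x ∈ Icc a b, ρ' x ≤ 0) (hpos : 0 ≤ ρ b) (hg : Continuous g)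
    (hM : ∀ x ∈ Icc a b, |∫ t in a..x, g t| ≤ M) :
    |∫ t in a..b, ρ t * g t| ≤ ρ a * M := by
  set G : ℝ → ℝ := fun x => ∫ t in a..x, g t with hG
  have hGd : ∀ x, HasDerivAt G (g x) x := fun x =>
    intervalIntegral.integral_hasDerivAt_right (hg.intervalIntegrable _ _)
      hg.aestronglyMeasurable.stronglyMeasurableAtFilter hg.continuousAt
  have hρi : IntervalIntegrable ρ' volume a b :=
    ContinuousOn.intervalIntegrable (by rwa [uIcc_of_le hab])
  have hGc : Continuous G := continuous_iff_continuousAt.2 fun x => (hGd x).continuousAt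
  have hparts := intervalIntegral.integral_mul_deriv_eq_deriv_mul (a := a) (b := b) (u := ρ)
    (v := G) (by rwa [uIcc_of_le hab]) (fun x _ => hGd x) hρi (hg.intervalIntegrable _ _)
  have hGa : G a = 0 := by simp [hG]
  have hftc : ∫ x in a..b, ρ' x = ρ b - ρ a :=
    intervalIntegral.integral_eq_sub_of_hasDerivAt (by rwa [uIcc_of_le hab]) hρi
  have hrem : |∫ x in a..b, ρ' x * G x| ≤ (ρ a - ρ b) * M := by
    have : (ρ a - ρ b) * M = ∫ x in a..b, -ρ' x * M := by
      rw [intervalIntegral.integral_mul_const, intervalIntegral.integral_neg, hftc]; ring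
    rw [this]
    rw [← Real.norm_eq_abs]
    refine intervalIntegral.norm_integral_le_of_norm_le hab (ae_of_all _ fun x hx => ?_)
      (hρi.neg.mul_const M)
    have hx' := Ioc_subset_Icc_self hx
    rw [norm_mul, Real.norm_of_nonpos (hneg x hx')]
    exact mul_le_mul_of_nonneg_left (hM x hx') (by linarith [hneg x hx'])
  rw [hparts, hGa, mul_zero, sub_zero]
  have hb : |ρ b * G b| ≤ ρ b * M := by
    rw [abs_mul, abs_of_nonneg hpos]
    exact mul_le_mul_of_nonneg_left (hM b ⟨hab, le_rfl⟩) hpos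
  calc _ ≤ |ρ b * G b| + |∫ x in a..b, ρ' x * G x| := abs_sub _ _
    _ ≤ _ := by linarith

/-- Density of the law of `(1 + U ^ (1 / β)) / 2`, with `U` uniform on `[0, 1]`. -/
noncomputable def powerDensity (β t : ℝ) : ℝ := 2 * β * (2 * t - 1) ^ (β - 1)

/-- Law of `(1 + U ^ (1 / β)) / 2`, with `U` uniform on `[0, 1]`. -/
noncomputable def powerLaw (β : ℝ) : Measure ℝ :=
  (volume.restrict (Ioc (1 / 2 : ℝ) 1)).withDensity fun t => ENNReal.ofReal (powerDensity β t)

lemma powerDensity_nonneg {β t : ℝ} (hβ : 0 < β) (ht : 1 / 2 ≤ t) : 0 ≤ powerDensity β t :=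
  mul_nonneg (by positivity) (Real.rpow_nonneg (by linarith) _)

lemma measurable_powerDensity (β : ℝ) : Measurable (powerDensity β) := by
  unfold powerDensity; fun_prop

lemma hasDerivAt_two_mul_sub_one_rpow (p : ℝ) {t : ℝ} (ht : 1 / 2 < t) :
    HasDerivAt (fun t : ℝ => (2 * t - 1) ^ p) (2 * p * (2 * t - 1) ^ (p - 1)) t := by
  have h : HasDerivAt (fun t : ℝ => 2 * t - 1) 2 t := by
    simpa using ((hasDerivAt_id t).const_mul 2).sub_const 1
  simpa using h.rpow_const (p := p) (Or.inl (by linarith))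

lemma continuous_two_mul_sub_one_rpow {β : ℝ} (hβ : 0 < β) :
    Continuous fun t : ℝ => (2 * t - 1) ^ β :=
  (by fun_prop : Continuous fun t : ℝ => 2 * t - 1).rpow_const fun _ => Or.inr hβ.le

lemma intervalIntegrable_powerDensity {β b : ℝ} (hβ : 0 < β) (hb : 1 / 2 ≤ b) :
    IntervalIntegrable (powerDensity β) volume (1 / 2) b := by
  refine intervalIntegral.intervalIntegrable_deriv_of_nonneg
    (g := fun t : ℝ => (2 * t - 1) ^ β)
    (continuous_two_mul_sub_one_rpow hβ).continuousOn (fun x hx => ?_) fun x hx => ?_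
  all_goals rw [min_eq_left hb] at hx
  · exact hasDerivAt_two_mul_sub_one_rpow β hx.1
  · exact powerDensity_nonneg hβ hx.1.le

lemma integral_powerDensity {β b : ℝ} (hβ : 0 < β) (hb : 1 / 2 ≤ b) :
    ∫ t in (1 / 2)..b, powerDensity β t = (2 * b - 1) ^ β := by
  rw [intervalIntegral.integral_eq_sub_of_hasDerivAt_of_le (f' := powerDensity β)
    (f := fun t : ℝ => (2 * t - 1) ^ β)
    hb (continuous_two_mul_sub_one_rpow hβ).continuousOn
    (fun x hx => hasDerivAt_two_mul_sub_one_rpow β hx.1) (intervalIntegrable_powerDensity hβ hb)]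
  norm_num [Real.zero_rpow hβ.ne']

lemma powerLaw_Ioc {β b : ℝ} (hβ : 0 < β) (hb : 1 / 2 ≤ b) (hb1 : b ≤ 1) :
    powerLaw β (Ioc (1 / 2) b) = ENNReal.ofReal ((2 * b - 1) ^ β) := by
  rw [powerLaw, withDensity_apply _ measurableSet_Ioc, Measure.restrict_restrict measurableSet_Ioc,
    Ioc_inter_Ioc, sup_idem, inf_eq_left.2 hb1, ← integral_powerDensity hβ hb,
    intervalIntegral.integral_of_le hb, ofReal_integral_eq_lintegral_ofReal]
  · exact (intervalIntegrable_iff_integrableOn_Ioc_of_le hb).1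
      (intervalIntegrable_powerDensity hβ hb)
  · exact (ae_restrict_mem measurableSet_Ioc).mono fun t ht => powerDensity_nonneg hβ ht.1.le

lemma powerLaw_compl_Ioc (β : ℝ) : powerLaw β (Ioc (1 / 2 : ℝ) 1)ᶜ = 0 := by
  refine withDensity_absolutelyContinuous _ _ ?_
  rw [Measure.restrict_apply measurableSet_Ioc.compl]
  simp

lemma isProbabilityMeasure_powerLaw {β : ℝ} (hβ : 0 < β) :
    IsProbabilityMeasure (powerLaw β) := by
  constructor
  have h := measure_add_measure_compl (μ := powerLaw β)
    (measurableSet_Ioc (a := (1 / 2 : ℝ)) (b := 1))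
  rw [powerLaw_compl_Ioc, add_zero, powerLaw_Ioc hβ (by norm_num) le_rfl] at h
  rw [← h]
  norm_num

lemma integral_powerLaw {β : ℝ} (hβ : 0 < β) (g : ℝ → ℝ) :
    ∫ t, g t ∂(powerLaw β) = ∫ t in (1 / 2 : ℝ)..1, powerDensity β t * g t := by
  rw [powerLaw, integral_withDensity_eq_integral_toReal_smul
    (measurable_powerDensity β).ennreal_ofReal (ae_of_all _ fun _ => ENNReal.ofReal_lt_top),
    intervalIntegral.integral_of_le (by norm_num)]
  refine setIntegral_congr_fun measurableSet_Ioc fun t ht => ?_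
  simp only [smul_eq_mul]
  rw [ENNReal.toReal_ofReal (powerDensity_nonneg hβ ht.1.le)]

lemma abs_integral_powerLaw_bernsteinOp_sub_le {β : ℝ} (hβ : 0 < β) (hβ1 : β ≤ 1) {n : ℕ}
    (hn : 1 ≤ n) {φ : ℝ → ℝ} (hφ : LipschitzWith 1 φ) :
    |∫ t, (bernsteinOp n φ t - φ t) ∂(powerLaw β)| ≤ 5 * (1 / √n) ^ (1 + β) := by
  have hn' : (0 : ℝ) < n := by positivity
  have hn1 : (1 : ℝ) ≤ n := by exact_mod_cast hn
  have hs1 : 1 ≤ √(n : ℝ) := Real.one_le_sqrt.2 hn1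
  have hs : 0 < √(n : ℝ) := by positivity
  have hss : √(n : ℝ) ^ 2 = n := Real.sq_sqrt hn'.le
  set x : ℝ := 1 / √n with hx
  have hx0 : 0 < x := by positivity
  have hx1 : x ≤ 1 := by rw [hx, div_le_one hs]; exact hs1
  have hx2 : 2 / (n : ℝ) = 2 * x ^ 2 := by rw [hx, div_pow, hss]; ring
  set a : ℝ := 1 / 2 + x / 2 with ha
  have hax : 2 * a - 1 = x := by rw [ha]; ring
  have ha0 : 1 / 2 < a := by linarith
  have ha1 : a ≤ 1 := by linarith
  set g : ℝ → ℝ := fun t => bernsteinOp n φ t - φ t with hg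
  have hgc : Continuous g := (continuous_bernsteinOp n φ).sub hφ.continuous
  have hI1 : IntervalIntegrable (fun t => powerDensity β t * g t) volume (1 / 2) a :=
    (intervalIntegrable_powerDensity hβ ha0.le).mul_continuousOn hgc.continuousOn
  have hI2 : IntervalIntegrable (fun t => powerDensity β t * g t) volume (1 / 2) 1 :=
    (intervalIntegrable_powerDensity hβ (by norm_num)).mul_continuousOn hgc.continuousOn
  have hnear : |∫ t in (1 / 2)..a, powerDensity β t * g t| ≤ x ^ β * x := by
    have : x ^ β * x = ∫ t in (1 / 2)..a, powerDensity β t * x := by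
      rw [intervalIntegral.integral_mul_const, integral_powerDensity hβ ha0.le, hax]
    rw [this]
    rw [← Real.norm_eq_abs]
    refine intervalIntegral.norm_integral_le_of_norm_le ha0.le (ae_of_all _ fun t ht => ?_)
      ((intervalIntegrable_powerDensity hβ ha0.le).mul_const x)
    have hp := powerDensity_nonneg hβ ht.1.le
    rw [norm_mul, Real.norm_of_nonneg hp]
    exact mul_le_mul_of_nonneg_left
      (hφ.abs_bernsteinOp_sub_le hn ⟨by linarith [ht.1], by linarith [ht.2]⟩) hp
  have hfar : |∫ t in a..1, powerDensity β t * g t| ≤ powerDensity β a * (2 / n) := by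
    refine abs_integral_mul_le_of_deriv_nonpos (ρ := powerDensity β)
      (ρ' := fun t => 2 * β * (2 * (β - 1) * (2 * t - 1) ^ (β - 1 - 1))) ha1
      (fun t ht => ?_) ?_ (fun t ht => ?_) (powerDensity_nonneg hβ (by norm_num)) hgc
      fun t ht => hφ.abs_integral_bernsteinOp_sub_le hn (by linarith) ht.1 ht.2
    · exact (hasDerivAt_two_mul_sub_one_rpow (β - 1) (by linarith [ht.1])).const_mul (2 * β)
    · refine continuousOn_const.mul (continuousOn_const.mul ?_)
      refine ContinuousOn.rpow_const (by fun_prop) fun t ht => Or.inl ?_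
      have := ht.1
      linarith
    · have h1 : 0 ≤ (2 * t - 1) ^ (β - 1 - 1) := Real.rpow_nonneg (by linarith [ht.1]) _
      exact mul_nonpos_of_nonneg_of_nonpos (by positivity)
        (mul_nonpos_of_nonpos_of_nonneg (by linarith) h1)
  rw [integral_powerLaw hβ, ← intervalIntegral.integral_add_adjacent_intervals hI1
    (hI1.symm.trans hI2)]
  have e1 : x ^ β * x = x ^ (1 + β) := by
    rw [add_comm, Real.rpow_add hx0, Real.rpow_one]
  have e2 : powerDensity β a * (2 / n) = 4 * β * x ^ (1 + β) := by
    have : x ^ (1 + β) = x ^ (β - 1) * x ^ 2 := by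
      rw [← Real.rpow_natCast, ← Real.rpow_add hx0]; congr 1; push_cast; ring
    rw [powerDensity, hax, hx2, this]; ring
  have hp : 0 < x ^ (1 + β) := by positivity
  calc _ ≤ x ^ β * x + powerDensity β a * (2 / n) := (abs_add_le _ _).trans (by gcongr)
    _ = (1 + 4 * β) * x ^ (1 + β) := by rw [e1, e2]; ring
    _ ≤ _ := by gcongr; linarith

lemma le_powerLaw_real_Icc {β : ℝ} (hβ : 0 < β) (hβ1 : β ≤ 1) {n : ℕ} (hn : 1 ≤ n) :
    1 / 50 * (1 / √n) ^ β ≤ (powerLaw β).real (Icc (1 / 2) (1 / 2 + 1 / (100 * √n))) := by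
  have := isProbabilityMeasure_powerLaw hβ
  have hn1 : (1 : ℝ) ≤ n := by exact_mod_cast hn
  have hs1 : 1 ≤ √(n : ℝ) := Real.one_le_sqrt.2 hn1
  have hs : 0 < √(n : ℝ) := by positivity
  have h0 : 0 < 1 / (100 * √(n : ℝ)) := by positivity
  have h100 : 1 / (100 * √(n : ℝ)) ≤ 1 / 100 := by gcongr; linarith
  have e : 2 * (1 / 2 + 1 / (100 * √(n : ℝ))) - 1 = 1 / 50 * (1 / √n) := by field_simp; ring
  calc _ ≤ (1 / 50 * (1 / √(n : ℝ))) ^ β := by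
        rw [Real.mul_rpow (by norm_num) (by positivity)]
        gcongr
        exact Real.self_le_rpow_of_le_one (by norm_num) (by norm_num) hβ1
    _ = (powerLaw β).real (Ioc (1 / 2) (1 / 2 + 1 / (100 * √n))) := by
        rw [measureReal_def, powerLaw_Ioc hβ (by linarith) (by linarith), ENNReal.toReal_ofReal
          (Real.rpow_nonneg (by linarith) _), e]
    _ ≤ _ := measureReal_mono Ioc_subset_Icc_self

/-- For every `δ ∈ [1/2, 1]` there is a mixing measure `μ` on `[0,1]` such that
`d_W(X̄ₙ, θ) ≍ n^{-δ}`. -/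
theorem stmt_10 (δ : ℝ) (hδ : δ ∈ Set.Icc (1 / 2 : ℝ) 1) :
    ∃ μ : Measure ℝ, IsProbabilityMeasure μ ∧ μ (Set.Icc (0 : ℝ) 1)ᶜ = 0 ∧
      ∃ c C : ℝ, 0 < c ∧ c ≤ C ∧
        ∀ n : ℕ, 1 ≤ n →
          c * (n : ℝ) ^ (-δ) ≤ dW (barLaw μ n) μ ∧
          dW (barLaw μ n) μ ≤ C * (n : ℝ) ^ (-δ) := by
  have hpow : ∀ n : ℕ, (n : ℝ) ^ (-δ) = (1 / √n) ^ (1 + (2 * δ - 1)) := fun n => by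
    rw [Real.sqrt_eq_rpow, one_div, ← Real.rpow_neg (by positivity),
      ← Real.rpow_mul (by positivity)]
    congr 1; ring
  rcases hδ.1.eq_or_lt with h | h
  · have h0 : (Measure.dirac (1 / 2 : ℝ)) (Icc (0 : ℝ) 1)ᶜ = 0 := by
      rw [Measure.dirac_apply' _ measurableSet_Icc.compl]
      simp; norm_num
    refine ⟨Measure.dirac (1 / 2), inferInstance, h0, 1 / 100, 1, by norm_num, by norm_num,
      fun n hn => ?_⟩
    have hb := dW_barLaw_bounds h0 hn (K := 1 / √n) fun φ hφ => by
      rw [integral_dirac]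
      exact hφ.abs_bernsteinOp_sub_le hn (by norm_num)
    have hm : (Measure.dirac (1 / 2 : ℝ)).real (Icc (1 / 2) (1 / 2 + 1 / (100 * √n))) = 1 := by
      have h1 : 0 ≤ 1 / (100 * √(n : ℝ)) := by positivity
      rw [measureReal_def, Measure.dirac_apply_of_mem (mem_Icc.2 ⟨le_rfl, by linarith⟩),
        ENNReal.toReal_one]
    rw [hm] at hb
    have e : (1 + (2 * δ - 1)) = 1 := by rw [← h]; norm_num
    rw [hpow, e, Real.rpow_one]
    refine ⟨le_trans (le_of_eq ?_) hb.1, hb.2.trans (one_mul _).ge⟩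
    field_simp
  · have hβ : 0 < 2 * δ - 1 := by linarith
    have hβ1 : 2 * δ - 1 ≤ 1 := by linarith [hδ.2]
    have := isProbabilityMeasure_powerLaw hβ
    have h0 : powerLaw (2 * δ - 1) (Icc (0 : ℝ) 1)ᶜ = 0 :=
      measure_mono_null (compl_subset_compl.2 fun t ht => ⟨by linarith [ht.1], ht.2⟩)
        (powerLaw_compl_Ioc _)
    refine ⟨powerLaw (2 * δ - 1), inferInstance, h0, 1 / 5000, 5, by norm_num, by norm_num,
      fun n hn => ?_⟩
    have hb := dW_barLaw_bounds h0 hn fun φ hφ =>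
      abs_integral_powerLaw_bernsteinOp_sub_le hβ hβ1 hn hφ
    have hm := le_powerLaw_real_Icc hβ hβ1 hn
    have hs : 0 < 1 / √(n : ℝ) := by positivity
    rw [hpow]
    refine ⟨le_trans ?_ hb.1, hb.2⟩
    calc _ = 1 / (100 * √n) * (1 / 50 * (1 / √n) ^ (2 * δ - 1)) := by
          rw [Real.rpow_add hs, Real.rpow_one]; field_simp; norm_num
      _ ≤ _ := by gcongr
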